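/- Let d ∈ {1,2,3}, let Ω ⊆ ℝ^d be a nonempty bounded open set and let b, c > 0. There exists C > 0 (depending only on d, Ω, b, c, and in particular not on T) such that for every T > 0 the following holds: if ψ is admissible, f : ℝ × ℝ^d → ℝ is continuous, v := ψ_t, and v_t − b Δv − c² Δψ = f on [0,T] × Ω, then sup_{t∈[0,T]}(‖v(t)‖² + ‖∇ψ(t)‖² + ‖∇v(t)‖²) + ∫₀ᵀ(‖∇v(t)‖² + ‖v_t(t)‖²) dt ≤ C(‖ψ(0)‖_{H¹}² + ‖v(0)‖_{H¹}² + ∫₀ᵀ‖f(t)‖² dt). -/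

import Mathlib

open MeasureTheory Real

noncomputable section

/-- Euclidean space ℝ^d. -/
abbrev Spc (d : ℕ) := EuclideanSpace ℝ (Fin d)

variable {d : ℕ}

/-- Spatial Laplacian: sum of second derivatives in the coordinate directions. -/
def lap (g : Spc d → ℝ) (x : Spc d) : ℝ :=
  ∑ i, fderiv ℝ (fun y => fderiv ℝ g y (EuclideanSpace.single i 1)) x (EuclideanSpace.single i 1)

/-- Squared L²(Ω) norm: ‖g‖² = ∫_Ω g². -/
def sqL2 (Ω : Set (Spc d)) (g : Spc d → ℝ) : ℝ := ∫ x in Ω, (g x) ^ 2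

/-- Squared L²(Ω) norm of the gradient: ‖∇g‖² = ∫_Ω |∇g|². -/
def sqGrad (Ω : Set (Spc d)) (g : Spc d → ℝ) : ℝ := ∫ x in Ω, ‖gradient g x‖ ^ 2

/-- Squared L²(Ω) norm of the Hessian: ‖D²g‖² = ∫_Ω |D²g|². -/
def sqHess (Ω : Set (Spc d)) (g : Spc d → ℝ) : ℝ := ∫ x in Ω, ‖iteratedFDeriv ℝ 2 g x‖ ^ 2

/-- Squared H¹(Ω) norm. -/
def sqH1 (Ω : Set (Spc d)) (g : Spc d → ℝ) : ℝ := sqL2 Ω g + sqGrad Ω g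

/-- Squared H²(Ω) norm. -/
def sqH2 (Ω : Set (Spc d)) (g : Spc d → ℝ) : ℝ := sqL2 Ω g + sqGrad Ω g + sqHess Ω g

/-- H⁻¹(Ω) norm by duality against smooth compactly supported test functions. -/
def negH1 (Ω : Set (Spc d)) (g : Spc d → ℝ) : ℝ :=
  sSup { r : ℝ | ∃ φ : Spc d → ℝ, ContDiff ℝ (⊤ : ℕ∞) φ ∧ HasCompactSupport φ ∧ tsupport φ ⊆ Ω ∧
      (∫ x in Ω, ‖gradient φ x‖ ^ 2) ≤ 1 ∧ r = ∫ x in Ω, g x * φ x }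

/-- Admissible: smooth in (t,x), with spatial support in a fixed compact subset of Ω. -/
def Admissible (Ω : Set (Spc d)) (w : ℝ → Spc d → ℝ) : Prop :=
  ContDiff ℝ (⊤ : ℕ∞) (fun p : ℝ × Spc d => w p.1 p.2) ∧
  ∃ K : Set (Spc d), IsCompact K ∧ K ⊆ Ω ∧ ∀ t, Function.support (w t) ⊆ K

/-- Inner product of two spatial gradients: ∇g·∇h. -/
def gdot (g h : Spc d → ℝ) (x : Spc d) : ℝ := @inner ℝ _ _ (gradient g x) (gradient h x)

/-- Time derivative. -/
def tderiv (w : ℝ → Spc d → ℝ) (t : ℝ) (x : Spc d) : ℝ := deriv (fun s => w s x) t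

/-- The Blackstock equation ψ_tt − c²(1 − 2k ψ_t)Δψ − b Δψ_t + 2σ ∇ψ·∇ψ_t = 0
holds at time `t` on `Ω`. -/
def IsBlackstock (Ω : Set (Spc d)) (b c k σ : ℝ) (ψ : ℝ → Spc d → ℝ) (t : ℝ) : Prop :=
  ∀ x ∈ Ω,
    (tderiv (tderiv ψ) t x - c ^ 2 * (1 - 2 * k * tderiv ψ t x) * lap (ψ t) x
      - b * lap (tderiv ψ t) x
      + 2 * σ * gdot (ψ t) (tderiv ψ t) x) = 0

/-- Energy E(t). -/
def energy (Ω : Set (Spc d)) (b c : ℝ) (ψ : ℝ → Spc d → ℝ) (t : ℝ) : ℝ :=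
  (1 / 2) * sqL2 Ω (tderiv ψ t) + (c ^ 2 / 2) * sqGrad Ω (ψ t)
    + (c ^ 2 / (2 * b)) * sqL2 Ω (lap (ψ t)) + sqGrad Ω (tderiv ψ t)

/-- Dissipation D(t). -/
def dissip (Ω : Set (Spc d)) (ψ : ℝ → Spc d → ℝ) (t : ℝ) : ℝ :=
  ∫ s in (0:ℝ)..t,
    (sqGrad Ω (tderiv ψ s) + sqL2 Ω (lap (tderiv ψ s)) + sqGrad Ω (ψ s)
      + sqL2 Ω (lap (ψ s)) + sqL2 Ω (tderiv (tderiv ψ) s))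

/-- Supremum of a function of time over [0,T]. -/
def supIcc (T : ℝ) (f : ℝ → ℝ) : ℝ := ⨆ t : Set.Icc (0:ℝ) T, f t

/-- f := −2k c² ψ_t Δψ − 2σ ∇ψ·∇ψ_t, the right-hand side nonlinearity. -/
def blackF (c k σ : ℝ) (ψ : ℝ → Spc d → ℝ) (t : ℝ) (x : Spc d) : ℝ :=
  -(2 * k * c ^ 2) * tderiv ψ t x * lap (ψ t) x - 2 * σ * gdot (ψ t) (tderiv ψ t) x

/-- The nonlocal heat equation v_t − b Δv − c² Δψ = f (with v = ψ_t) holds at time `t` on `Ω`. -/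
def IsHeat (Ω : Set (Spc d)) (b c : ℝ) (ψ f : ℝ → Spc d → ℝ) (t : ℝ) : Prop :=
  ∀ x ∈ Ω,
    tderiv (tderiv ψ) t x - b * lap (tderiv ψ t) x - c ^ 2 * lap (ψ t) x = f t x

/-- The linearized Blackstock equation
ψ_tt − c²(1 − 2k α)Δψ − b Δψ_t + 2σ ∇ψ·∇α = f̃ holds at time `t` on `Ω`. -/
def IsLinBlackstock (Ω : Set (Spc d)) (b c k σ : ℝ) (α ψ f : ℝ → Spc d → ℝ) (t : ℝ) : Prop :=
  ∀ x ∈ Ω,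
    tderiv (tderiv ψ) t x - c ^ 2 * (1 - 2 * k * α t x) * lap (ψ t) x
      - b * lap (tderiv ψ t) x + 2 * σ * gdot (ψ t) (α t) x = f t x

/-- Time-weighted norm N_T^v for the velocity variable. -/
def normV (Ω : Set (Spc d)) (T : ℝ) (α : ℝ → Spc d → ℝ) : ℝ :=
  supIcc T (fun t => Real.sqrt (sqH1 Ω (α t)))
    + Real.sqrt (∫ t in (0:ℝ)..T, (sqL2 Ω (α t) + sqGrad Ω (α t) + sqL2 Ω (lap (α t))))
    + Real.sqrt (∫ t in (0:ℝ)..T, sqL2 Ω (tderiv α t))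
    + supIcc T (fun t => Real.sqrt t * Real.sqrt (sqL2 Ω (tderiv α t)))
    + Real.sqrt (∫ t in (0:ℝ)..T, t * sqGrad Ω (tderiv α t))
    + supIcc T (fun t => Real.sqrt t * Real.sqrt (sqL2 Ω (lap (α t))))

/-- Time-weighted solution norm N_T(ψ) = sup_{[0,T]} ‖ψ(t)‖_{H²} + N_T^v(ψ_t). -/
def normX (Ω : Set (Spc d)) (T : ℝ) (ψ : ℝ → Spc d → ℝ) : ℝ :=
  supIcc T (fun t => Real.sqrt (sqH2 Ω (ψ t))) + normV Ω T (tderiv ψ)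

/-- Spatial partial derivative. -/
def pd (i : Fin d) (w : ℝ → Spc d → ℝ) (t : ℝ) (x : Spc d) : ℝ :=
  fderiv ℝ (w t) x (EuclideanSpace.single i 1)

/-- Pairing over Ω at a fixed time. -/
def pair (Ω : Set (Spc d)) (u w : ℝ → Spc d → ℝ) (t : ℝ) : ℝ := ∫ x in Ω, u t x * w t x

lemma tderiv_eq {w : ℝ → Spc d → ℝ}
    (h : ContDiff ℝ (⊤ : ℕ∞) (fun p : ℝ × Spc d => w p.1 p.2)) (t : ℝ) (x : Spc d) :
    tderiv w t x = fderiv ℝ (fun p : ℝ × Spc d => w p.1 p.2) (t, x) (1, 0) := by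
  have h1 : HasFDerivAt (fun p : ℝ × Spc d => w p.1 p.2) _ (t, x) :=
    (h.differentiable (by simp) (t, x)).hasFDerivAt
  have h2 : HasDerivAt (fun s : ℝ => (s, x)) ((1 : ℝ), (0 : Spc d)) t :=
    (hasDerivAt_id t).prodMk (hasDerivAt_const t x)
  exact (h1.comp_hasDerivAt t h2).deriv

lemma pd_eq {w : ℝ → Spc d → ℝ}
    (h : ContDiff ℝ (⊤ : ℕ∞) (fun p : ℝ × Spc d => w p.1 p.2)) (i : Fin d) (t : ℝ) (x : Spc d) :
    pd i w t x = fderiv ℝ (fun p : ℝ × Spc d => w p.1 p.2) (t, x)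
      (0, EuclideanSpace.single i 1) := by
  have h1 : HasFDerivAt (fun p : ℝ × Spc d => w p.1 p.2) _ (t, x) :=
    (h.differentiable (by simp) (t, x)).hasFDerivAt
  have h2 : HasFDerivAt (fun y : Spc d => (t, y)) (ContinuousLinearMap.inr ℝ ℝ (Spc d)) x :=
    hasFDerivAt_prodMk_right t x
  have h3 := (h1.comp x h2).fderiv
  unfold pd
  have h4 : w t = (fun p : ℝ × Spc d => w p.1 p.2) ∘ fun y : Spc d => (t, y) := rfl
  rw [h4, h3]; rfl

lemma contDiff_dir {W : ℝ × Spc d → ℝ} (h : ContDiff ℝ (⊤ : ℕ∞) W) (e : ℝ × Spc d) :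
    ContDiff ℝ (⊤ : ℕ∞) (fun p => fderiv ℝ W p e) :=
  (h.fderiv_right (m := (⊤ : ℕ∞)) (by simp)).clm_apply contDiff_const

lemma Admissible.tderiv {Ω : Set (Spc d)} {w : ℝ → Spc d → ℝ} (h : Admissible Ω w) :
    Admissible Ω (tderiv w) := by
  obtain ⟨hs, K, hK, hKΩ, hsup⟩ := h
  refine ⟨?_, K, hK, hKΩ, ?_⟩
  · simp_rw [tderiv_eq hs]
    exact contDiff_dir hs _
  · intro t x hx
    by_contra hxK
    apply hx
    have : (fun s => w s x) = fun _ => 0 := by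
      funext s
      by_contra h0
      exact hxK (hsup s h0)
    simp [_root_.tderiv, this]

lemma Admissible.pd {Ω : Set (Spc d)} {w : ℝ → Spc d → ℝ} (h : Admissible Ω w) (i : Fin d) :
    Admissible Ω (pd i w) := by
  obtain ⟨hs, K, hK, hKΩ, hsup⟩ := h
  refine ⟨?_, K, hK, hKΩ, ?_⟩
  · simp_rw [pd_eq hs]
    exact contDiff_dir hs _
  · intro t x hx
    by_contra hxK
    apply hx
    have : w t =ᶠ[nhds x] fun _ => 0 := by
      filter_upwards [hK.isClosed.isOpen_compl.mem_nhds hxK] with y hy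
      by_contra h0
      exact hy (hsup t h0)
    simp [_root_.pd, this.fderiv_eq]

lemma tderiv_pd {Ω : Set (Spc d)} {w : ℝ → Spc d → ℝ} (h : Admissible Ω w) (i : Fin d) :
    tderiv (pd i w) = pd i (tderiv w) := by
  funext t x
  rw [tderiv_eq (h.pd i).1, pd_eq h.tderiv.1]
  simp_rw [pd_eq h.1, tderiv_eq h.1]
  set W : ℝ × Spc d → ℝ := fun p => w p.1 p.2 with hW
  have hd2 : DifferentiableAt ℝ (fderiv ℝ W) (t, x) :=
    ((h.1.fderiv_right (m := (⊤ : ℕ∞)) (by simp)).differentiable (by simp)) _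
  have key := (h.1.contDiffAt (x := (t, x))).isSymmSndFDerivAt
    (by simp only [minSmoothness_of_isRCLikeNormedField]; exact WithTop.coe_le_coe.2 le_top)
  have e : ∀ v u : ℝ × Spc d, fderiv ℝ (fun p => fderiv ℝ W p v) (t, x) u
      = fderiv ℝ (fderiv ℝ W) (t, x) u v := by
    intro v u
    rw [fderiv_clm_apply hd2 (differentiableAt_const v)]
    simp
  have e1 := e (0, EuclideanSpace.single i 1) (1, 0)
  have e2 := e (1, 0) (0, EuclideanSpace.single i 1)
  exact e1.trans ((key _ _).trans e2.symm)

lemma Admissible.add {Ω : Set (Spc d)} {u w : ℝ → Spc d → ℝ} (hu : Admissible Ω u)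
    (hw : Admissible Ω w) : Admissible Ω (fun t x => u t x + w t x) := by
  obtain ⟨hs, K, hK, hKΩ, hsup⟩ := hu
  obtain ⟨hs', K', hK', hKΩ', hsup'⟩ := hw
  refine ⟨hs.add hs', K ∪ K', hK.union hK', Set.union_subset hKΩ hKΩ', fun t => ?_⟩
  exact (Function.support_add _ _).trans (Set.union_subset_union (hsup t) (hsup' t))

lemma Admissible.cmul {Ω : Set (Spc d)} {u : ℝ → Spc d → ℝ} (hu : Admissible Ω u) (a : ℝ) :
    Admissible Ω (fun t x => a * u t x) := by
  obtain ⟨hs, K, hK, hKΩ, hsup⟩ := hu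
  refine ⟨contDiff_const.mul hs, K, hK, hKΩ, fun t x hx => hsup t ?_⟩
  intro h0
  exact hx (by simp [h0])

lemma Admissible.mul {Ω : Set (Spc d)} {u w : ℝ → Spc d → ℝ} (hu : Admissible Ω u)
    (hw : Admissible Ω w) : Admissible Ω (fun t x => u t x * w t x) := by
  obtain ⟨hs, K, hK, hKΩ, hsup⟩ := hu
  refine ⟨hs.mul hw.1, K, hK, hKΩ, fun t x hx => hsup t ?_⟩
  intro h0
  exact hx (by simp [h0])

lemma Admissible.zero {Ω : Set (Spc d)} : Admissible Ω (fun _ _ => (0 : ℝ)) :=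
  ⟨contDiff_const, ∅, isCompact_empty, Set.empty_subset _, fun t => by simp⟩

lemma Admissible.sum {Ω : Set (Spc d)} {ι : Type*} (s : Finset ι) {u : ι → ℝ → Spc d → ℝ}
    (hu : ∀ i, Admissible Ω (u i)) : Admissible Ω (fun t x => ∑ i ∈ s, u i t x) := by
  classical
  induction s using Finset.induction_on with
  | empty => simpa using Admissible.zero
  | insert a s ha ih =>
    simp_rw [Finset.sum_insert ha]
    exact (hu a).add ih

lemma Admissible.cont {Ω : Set (Spc d)} {u : ℝ → Spc d → ℝ} (hu : Admissible Ω u) (t : ℝ) :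
    ContDiff ℝ (⊤ : ℕ∞) (u t) :=
  hu.1.comp (contDiff_const.prodMk contDiff_id)

lemma Admissible.hcs {Ω : Set (Spc d)} {u : ℝ → Spc d → ℝ} (hu : Admissible Ω u) (t : ℝ) :
    HasCompactSupport (u t) := by
  obtain ⟨hs, K, hK, hKΩ, hsup⟩ := hu
  exact HasCompactSupport.of_support_subset_isCompact hK (hsup t)

lemma Admissible.integrable {Ω : Set (Spc d)} {u : ℝ → Spc d → ℝ} (hu : Admissible Ω u) (t : ℝ) :
    Integrable (u t) :=
  (hu.cont t).continuous.integrable_of_hasCompactSupport (hu.hcs t)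

lemma Admissible.setInt {Ω : Set (Spc d)} {u : ℝ → Spc d → ℝ} (hu : Admissible Ω u) (t : ℝ) :
    ∫ x in Ω, u t x = ∫ x, u t x := by
  obtain ⟨hs, K, hK, hKΩ, hsup⟩ := hu
  exact setIntegral_eq_integral_of_forall_compl_eq_zero
    (fun x hx => by by_contra h0; exact hx (hKΩ (hsup t h0)))

lemma Admissible.hasDerivAt_t {Ω : Set (Spc d)} {u : ℝ → Spc d → ℝ} (hu : Admissible Ω u)
    (t : ℝ) (x : Spc d) : HasDerivAt (fun s => u s x) (_root_.tderiv u t x) t := by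
  have : ContDiff ℝ (⊤ : ℕ∞) (fun s => u s x) :=
    hu.1.comp (contDiff_id.prodMk contDiff_const)
  exact (this.differentiable (by simp) t).hasDerivAt

/-- Differentiation under the integral. -/
lemma Admissible.hasDerivAt_int {Ω : Set (Spc d)} {u : ℝ → Spc d → ℝ} (hu : Admissible Ω u)
    (t : ℝ) : HasDerivAt (fun s => ∫ x in Ω, u s x) (∫ x in Ω, _root_.tderiv u t x) t := by
  have hv := hu.tderiv
  obtain ⟨hvs, K, hK, hKΩ, hsup⟩ := id hv
  obtain ⟨M, hM⟩ := ((isCompact_Icc (a := t - 1) (b := t + 1)).prod hK).bddAbove_image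
    (f := fun p : ℝ × Spc d => ‖_root_.tderiv u p.1 p.2‖) hvs.continuous.norm.continuousOn
  refine (hasDerivAt_integral_of_dominated_loc_of_deriv_le (μ := volume.restrict Ω)
    (F := fun s x => u s x) (F' := fun s x => _root_.tderiv u s x) (s := Set.Icc (t - 1) (t + 1))
    (bound := K.indicator fun _ => M)
    (Icc_mem_nhds (by linarith) (by linarith)) ?_ ?_ ?_ ?_ ?_ ?_).2
  · exact Filter.Eventually.of_forall fun s => (hu.integrable s).aestronglyMeasurable.restrict
  · exact (hu.integrable t).restrict
  · exact (hv.integrable t).aestronglyMeasurable.restrict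
  · refine Filter.Eventually.of_forall fun x s hs => ?_
    by_cases hx : x ∈ K
    · rw [Set.indicator_of_mem hx]
      exact hM ⟨(s, x), ⟨hs, hx⟩, rfl⟩
    · rw [Set.indicator_of_notMem hx]
      have : _root_.tderiv u s x = 0 := by by_contra h0; exact hx (hsup s h0)
      simp [this]
  · apply Integrable.restrict
    rw [integrable_indicator_iff hK.isClosed.measurableSet]
    exact integrableOn_const hK.measure_lt_top.ne
  · exact Filter.Eventually.of_forall fun x s _ => hu.hasDerivAt_t s x

lemma hasDerivAt_pair {Ω : Set (Spc d)} {u w : ℝ → Spc d → ℝ} (hu : Admissible Ω u)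
    (hw : Admissible Ω w) (t : ℝ) :
    HasDerivAt (pair Ω u w) (pair Ω (tderiv u) w t + pair Ω u (tderiv w) t) t := by
  have h := (hu.mul hw).hasDerivAt_int t
  refine h.congr_deriv ?_
  unfold pair
  rw [← integral_add ((hu.tderiv.mul hw).integrable t).restrict
    ((hu.mul hw.tderiv).integrable t).restrict]
  congr 1
  funext x
  exact ((hu.hasDerivAt_t t x).mul (hw.hasDerivAt_t t x)).deriv

lemma continuous_pair {Ω : Set (Spc d)} {u w : ℝ → Spc d → ℝ} (hu : Admissible Ω u)
    (hw : Admissible Ω w) : Continuous (pair Ω u w) :=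
  continuous_iff_continuousAt.2 fun t => (hasDerivAt_pair hu hw t).continuousAt

lemma pair_comm (Ω : Set (Spc d)) (u w : ℝ → Spc d → ℝ) (t : ℝ) :
    pair Ω u w t = pair Ω w u t := by
  unfold pair; simp_rw [mul_comm]

lemma pair_self_nonneg (Ω : Set (Spc d)) (u : ℝ → Spc d → ℝ) (t : ℝ) : 0 ≤ pair Ω u u t :=
  integral_nonneg fun _ => mul_self_nonneg _

/-- Weighted Young inequality. -/
lemma pair_young {Ω : Set (Spc d)} {u w : ℝ → Spc d → ℝ} (hu : Admissible Ω u)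
    (hw : Admissible Ω w) (t : ℝ) {a : ℝ} (ha : 0 < a) :
    |pair Ω u w t| ≤ a / 2 * pair Ω u u t + 1 / (2 * a) * pair Ω w w t := by
  have i1 := ((hu.mul hu).integrable t).restrict (s := Ω)
  have i2 := ((hw.mul hw).integrable t).restrict (s := Ω)
  unfold pair
  rw [← integral_const_mul, ← integral_const_mul,
    ← integral_add (i1.const_mul _) (i2.const_mul _)]
  refine (abs_integral_le_integral_abs).trans ?_
  refine integral_mono ((hu.mul hw).integrable t).restrict.abs
    ((i1.const_mul _).add (i2.const_mul _)) fun x => ?_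
  have e : ∀ p q : ℝ, |p * q| ≤ a / 2 * (p * p) + 1 / (2 * a) * (q * q) := by
    intro p q
    have e1 : a / 2 * (p * p) + 1 / (2 * a) * (q * q) - p * q = (a * p - q) ^ 2 / (2 * a) := by
      field_simp; ring
    have e2 : a / 2 * (p * p) + 1 / (2 * a) * (q * q) + p * q = (a * p + q) ^ 2 / (2 * a) := by
      field_simp; ring
    have p1 : 0 ≤ (a * p - q) ^ 2 / (2 * a) := by positivity
    have p2 : 0 ≤ (a * p + q) ^ 2 / (2 * a) := by positivity
    rw [abs_le]; constructor <;> linarith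
  exact e _ _

/-- Integration by parts. -/
lemma pair_pd {Ω : Set (Spc d)} {u w : ℝ → Spc d → ℝ} (hu : Admissible Ω u)
    (hw : Admissible Ω w) (i : Fin d) (t : ℝ) :
    pair Ω u (pd i w) t = - pair Ω (pd i u) w t := by
  unfold pair
  rw [(hu.mul (hw.pd i)).setInt t, ((hu.pd i).mul hw).setInt t]
  exact integral_mul_fderiv_eq_neg_fderiv_mul_of_integrable
    (((hu.pd i).mul hw).integrable t) ((hu.mul (hw.pd i)).integrable t) ((hu.mul hw).integrable t)
    (fun x _ => (hu.cont t).differentiable (by simp) x)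
    (fun x _ => (hw.cont t).differentiable (by simp) x)

lemma sqL2_eq (Ω : Set (Spc d)) (u : ℝ → Spc d → ℝ) (t : ℝ) : sqL2 Ω (u t) = pair Ω u u t := by
  unfold sqL2 pair; simp_rw [sq]

lemma sqGrad_eq {Ω : Set (Spc d)} {u : ℝ → Spc d → ℝ} (hu : Admissible Ω u) (t : ℝ) :
    sqGrad Ω (u t) = ∑ i, pair Ω (pd i u) (pd i u) t := by
  unfold sqGrad pair
  rw [← integral_finsetSum]
  · congr 1
    funext x
    rw [EuclideanSpace.norm_sq_eq]
    refine Finset.sum_congr rfl fun i _ => ?_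
    have : gradient (u t) x i = pd i u t x := by
      unfold pd
      rw [← inner_gradient_left (𝕜 := ℝ)]
      rw [EuclideanSpace.inner_single_right]
      simp
    rw [this, Real.norm_eq_abs, sq_abs, sq]
  · intro i _
    exact (((hu.pd i).mul (hu.pd i)).integrable t).restrict

/-- Poincaré inequality. -/
lemma poincare {Ω : Set (Spc d)} {R : ℝ} (hR : ∀ x ∈ Ω, ‖x‖ ≤ R)
    {u : ℝ → Spc d → ℝ} (hu : Admissible Ω u) (i : Fin d) (t : ℝ) :
    pair Ω u u t ≤ 4 * R ^ 2 * pair Ω (pd i u) (pd i u) t := by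
  have hxu : Admissible Ω (fun t x => x i * u t x) := by
    obtain ⟨hs, K, hK, hKΩ, hsup⟩ := hu
    refine ⟨ContDiff.mul (by fun_prop) hs, K, hK, hKΩ, fun t x hx => hsup t ?_⟩
    intro h0
    exact hx (by simp [h0])
  have hpd : ∀ x, pd i (fun t x => x i * u t x) t x = u t x + x i * pd i u t x := by
    intro x
    unfold pd
    have h1 : HasFDerivAt (fun y : Spc d => y i) (EuclideanSpace.proj i : Spc d →L[ℝ] ℝ) x :=
      (EuclideanSpace.proj i : Spc d →L[ℝ] ℝ).hasFDerivAt
    have h2 := ((hu.cont t).differentiable (by simp) x).hasFDerivAt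
    have h3 : fderiv ℝ (fun y : Spc d => y i * u t y) x = _ := (h1.mul h2).fderiv
    rw [h3]
    simp; ring
  have key := pair_pd hu hxu i t
  have i1 := (hu.mul hu).integrable t |>.restrict (s := Ω)
  have i2 := ((hu.pd i).mul hxu).integrable t |>.restrict (s := Ω)
  have i3 := (hu.mul (hxu.pd i)).integrable t |>.restrict (s := Ω)
  have i4 := ((hu.pd i).mul (hu.pd i)).integrable t |>.restrict (s := Ω)
  have hnn : 0 ≤ ∫ x in Ω, ((4 * R ^ 2 * (pd i u t x * pd i u t x) - u t x * u t x)
      + 2 * (u t x * pd i (fun t x => x i * u t x) t x + pd i u t x * (x i * u t x))) := by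
    refine integral_nonneg fun x => ?_
    by_cases hx : x ∈ Ω
    · have hxi : (x i) ^ 2 ≤ R ^ 2 := by
        have := (PiLp.norm_apply_le x i).trans (hR x hx)
        rw [Real.norm_eq_abs] at this
        exact sq_le_sq' (by linarith [neg_abs_le (x i)]) ((le_abs_self _).trans this)
      simp only [hpd, Pi.zero_apply]
      nlinarith [sq_nonneg (u t x + 2 * (x i * pd i u t x)),
        mul_le_mul_of_nonneg_right hxi (sq_nonneg (pd i u t x))]
    · obtain ⟨_, K, _, hKΩ, hsup⟩ := id hu
      have h0 : u t x = 0 := by by_contra h0; exact hx (hKΩ (hsup t h0))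
      simp only [h0, Pi.zero_apply]
      nlinarith [mul_nonneg (sq_nonneg R) (mul_self_nonneg (pd i u t x))]
  have i5 : Integrable (fun x => 4 * R ^ 2 * (pd i u t x * pd i u t x) - u t x * u t x)
      (volume.restrict Ω) := (i4.const_mul _).sub i1
  have i6 : Integrable (fun x => 2 * (u t x * pd i (fun t x => x i * u t x) t x
      + pd i u t x * (x i * u t x))) (volume.restrict Ω) := (i3.add i2).const_mul 2
  rw [integral_add i5 i6, integral_sub (i4.const_mul _) i1, integral_const_mul, integral_const_mul, integral_add i3 i2] at hnn
  unfold pair at key ⊢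
  linarith

/-- The residual v_t − b Δv − c² Δψ. -/
def resid (b c : ℝ) (ψ : ℝ → Spc d → ℝ) (t : ℝ) (x : Spc d) : ℝ :=
  tderiv (tderiv ψ) t x + (-b * (∑ i, pd i (pd i (tderiv ψ)) t x)
    + -c ^ 2 * (∑ i, pd i (pd i ψ) t x))

lemma Admissible.resid {Ω : Set (Spc d)} {ψ : ℝ → Spc d → ℝ} (h : Admissible Ω ψ) (b c : ℝ) :
    Admissible Ω (resid b c ψ) :=
  h.tderiv.tderiv.add
    (((Admissible.sum Finset.univ fun i => (h.tderiv.pd i).pd i).cmul (-b)).add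
      ((Admissible.sum Finset.univ fun i => (h.pd i).pd i).cmul (-c ^ 2)))

lemma pair_add {Ω : Set (Spc d)} {u w z : ℝ → Spc d → ℝ} (hu : Admissible Ω u)
    (hw : Admissible Ω w) (hz : Admissible Ω z) (t : ℝ) :
    pair Ω u (fun t x => w t x + z t x) t = pair Ω u w t + pair Ω u z t := by
  unfold pair
  simp_rw [mul_add]
  exact integral_add ((hu.mul hw).integrable t).restrict ((hu.mul hz).integrable t).restrict

lemma pair_cmul {Ω : Set (Spc d)} {u w : ℝ → Spc d → ℝ} (a t : ℝ) :
    pair Ω u (fun t x => a * w t x) t = a * pair Ω u w t := by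
  unfold pair
  simp_rw [mul_left_comm _ a]
  exact integral_const_mul _ _

lemma pair_lap {Ω : Set (Spc d)} {u w : ℝ → Spc d → ℝ} (hu : Admissible Ω u)
    (hw : Admissible Ω w) (t : ℝ) :
    pair Ω u (fun t x => ∑ i, pd i (pd i w) t x) t = - ∑ i, pair Ω (pd i u) (pd i w) t := by
  rw [← Finset.sum_neg_distrib]
  simp_rw [← fun i => pair_pd hu (hw.pd i) i t]
  unfold pair
  simp_rw [Finset.mul_sum]
  exact integral_finsetSum _ fun i _ => ((hu.mul ((hw.pd i).pd i)).integrable t).restrict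

lemma pair_resid {Ω : Set (Spc d)} {u ψ : ℝ → Spc d → ℝ} (hu : Admissible Ω u)
    (h : Admissible Ω ψ) (b c t : ℝ) :
    pair Ω u (resid b c ψ) t = pair Ω u (tderiv (tderiv ψ)) t
      + b * ∑ i, pair Ω (pd i u) (pd i (tderiv ψ)) t
      + c ^ 2 * ∑ i, pair Ω (pd i u) (pd i ψ) t := by
  have hv := h.tderiv
  have a1 := Admissible.sum Finset.univ fun i => (hv.pd i).pd i
  have a2 := Admissible.sum Finset.univ fun i => (h.pd i).pd i
  unfold resid
  rw [pair_add hu hv.tderiv ((a1.cmul (-b)).add (a2.cmul (-c ^ 2))),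
    pair_add hu (a1.cmul (-b)) (a2.cmul (-c ^ 2)), pair_cmul, pair_cmul,
    pair_lap hu hv, pair_lap hu h]
  ring

/-- The modified energy. -/
def En (Ω : Set (Spc d)) (L b c : ℝ) (ψ : ℝ → Spc d → ℝ) (t : ℝ) : ℝ :=
  L * (1 / 2 * pair Ω (tderiv ψ) (tderiv ψ) t + c ^ 2 / 2 * ∑ i, pair Ω (pd i ψ) (pd i ψ) t)
    + b / 2 * ∑ i, pair Ω (pd i (tderiv ψ)) (pd i (tderiv ψ)) t
    + c ^ 2 * ∑ i, pair Ω (pd i ψ) (pd i (tderiv ψ)) t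

lemma hasDerivAt_En {Ω : Set (Spc d)} {ψ : ℝ → Spc d → ℝ} (h : Admissible Ω ψ) (L b c t : ℝ) :
    HasDerivAt (En Ω L b c ψ)
      (L * (pair Ω (tderiv ψ) (resid b c ψ) t
          - b * ∑ i, pair Ω (pd i (tderiv ψ)) (pd i (tderiv ψ)) t)
        + pair Ω (tderiv (tderiv ψ)) (resid b c ψ) t
        - pair Ω (tderiv (tderiv ψ)) (tderiv (tderiv ψ)) t
        + c ^ 2 * ∑ i, pair Ω (pd i (tderiv ψ)) (pd i (tderiv ψ)) t) t := by
  have hv := h.tderiv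
  have d1 := hasDerivAt_pair hv hv t
  have d2 := HasDerivAt.fun_sum (u := Finset.univ)
    fun i _ => hasDerivAt_pair (h.pd i) (h.pd i) t
  have d3 := HasDerivAt.fun_sum (u := Finset.univ)
    fun i _ => hasDerivAt_pair (hv.pd i) (hv.pd i) t
  have d4 := HasDerivAt.fun_sum (u := Finset.univ)
    fun i _ => hasDerivAt_pair (h.pd i) (hv.pd i) t
  have D := ((((d1.const_mul (1 / 2)).add (d2.const_mul (c ^ 2 / 2))).const_mul L).add
    (d3.const_mul (b / 2))).add (d4.const_mul (c ^ 2))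
  refine HasDerivAt.congr_deriv (f := En Ω L b c ψ) D ?_
  rw [pair_resid hv h, pair_resid hv.tderiv h]
  simp only [tderiv_pd h, tderiv_pd hv, Finset.sum_add_distrib]
  simp only [fun i => pair_comm Ω (pd i ψ) (pd i (tderiv ψ)) t,
    fun i => pair_comm Ω (pd i (tderiv ψ)) (pd i (tderiv (tderiv ψ))) t,
    fun i => pair_comm Ω (pd i ψ) (pd i (tderiv (tderiv ψ))) t,
    pair_comm Ω (tderiv ψ) (tderiv (tderiv ψ)) t]
  ring

/-- T-independent energy estimate for the nonlocal heat equation. -/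
theorem heat_energy_estimate (d : ℕ) (hd : d = 1 ∨ d = 2 ∨ d = 3)
    (Ω : Set (Spc d)) (hne : Ω.Nonempty) (hop : IsOpen Ω) (hbd : Bornology.IsBounded Ω)
    (b c : ℝ) (hb : 0 < b) (hc : 0 < c) :
    ∃ C > (0:ℝ), ∀ T : ℝ, 0 < T →
      ∀ ψ f : ℝ → Spc d → ℝ, Admissible Ω ψ →
        Continuous (fun p : ℝ × Spc d => f p.1 p.2) →
        (∀ t ∈ Set.Icc (0:ℝ) T, IsHeat Ω b c ψ f t) →
        supIcc T (fun t => sqL2 Ω (tderiv ψ t) + sqGrad Ω (ψ t) + sqGrad Ω (tderiv ψ t))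
          + (∫ t in (0:ℝ)..T, (sqGrad Ω (tderiv ψ t) + sqL2 Ω (tderiv (tderiv ψ) t)))
        ≤ C * (sqH1 Ω (ψ 0) + sqH1 Ω (tderiv ψ 0) + ∫ t in (0:ℝ)..T, sqL2 Ω (f t)) := by

  obtain ⟨R, hR⟩ := hbd.exists_norm_le
  have i0 : Fin d := ⟨0, by omega⟩
  set P : ℝ := 4 * R ^ 2 + 1 with hP
  have hP0 : 0 < P := by positivity
  set L : ℝ := 2 * c ^ 2 / b + 2 with hL
  have hL0 : 0 < L := by positivity
  have hLb : L * b = 2 * c ^ 2 + 2 * b := by rw [hL]; field_simp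
  set M : ℝ := L * (P / (2 * b)) + 1 / 2 with hM
  have hM0 : 0 < M := by positivity
  set k : ℝ := min 1 (min (c ^ 2) (b / 4)) with hk
  have hk0 : 0 < k := by positivity
  have hk1 : k ≤ 1 := min_le_left _ _
  have hk2 : k ≤ c ^ 2 := (min_le_right _ _).trans (min_le_left _ _)
  have hk3 : k ≤ b / 4 := (min_le_right _ _).trans (min_le_right _ _)
  set δ : ℝ := min b (1 / 2) with hδ
  have hδ0 : 0 < δ := by positivity
  have hδ1 : δ ≤ b := min_le_left _ _
  have hδ2 : δ ≤ 1 / 2 := min_le_right _ _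
  set k2 : ℝ := L / 2 + (L * c ^ 2 / 2 + c ^ 4 / b) + 3 * b / 4 with hkk
  have hk20 : 0 < k2 := by positivity
  refine ⟨(1 / k + 1 / δ) * (k2 + M), by positivity, ?_⟩
  intro T hT ψ f hψ _ heat
  have hv := hψ.tderiv
  have hg := hψ.resid b c
  set V : ℝ → ℝ := fun t => pair Ω (tderiv ψ) (tderiv ψ) t with hVd
  set A : ℝ → ℝ := fun t => ∑ i, pair Ω (pd i ψ) (pd i ψ) t with hAd
  set G : ℝ → ℝ := fun t => ∑ i, pair Ω (pd i (tderiv ψ)) (pd i (tderiv ψ)) t with hGd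
  set X : ℝ → ℝ := fun t => ∑ i, pair Ω (pd i ψ) (pd i (tderiv ψ)) t with hXd
  set W : ℝ → ℝ := fun t => pair Ω (tderiv (tderiv ψ)) (tderiv (tderiv ψ)) t with hWd
  set F : ℝ → ℝ := fun t => pair Ω (resid b c ψ) (resid b c ψ) t with hFd
  have V0 : ∀ t, 0 ≤ V t := fun t => pair_self_nonneg _ _ _
  have A0 : ∀ t, 0 ≤ A t := fun t => Finset.sum_nonneg fun i _ => pair_self_nonneg _ _ _
  have G0 : ∀ t, 0 ≤ G t := fun t => Finset.sum_nonneg fun i _ => pair_self_nonneg _ _ _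
  have W0 : ∀ t, 0 ≤ W t := fun t => pair_self_nonneg _ _ _
  have F0 : ∀ t, 0 ≤ F t := fun t => pair_self_nonneg _ _ _
  have cG : Continuous G := continuous_finsetSum _ fun i _ => continuous_pair (hv.pd i) (hv.pd i)
  have cW : Continuous W := continuous_pair hv.tderiv hv.tderiv
  have cF : Continuous F := continuous_pair hg hg
  have hVG : ∀ t, V t ≤ P * G t := by
    intro t
    have h1 := poincare hR hv i0 t
    have h2 : pair Ω (pd i0 (tderiv ψ)) (pd i0 (tderiv ψ)) t ≤ G t :=
      Finset.single_le_sum (f := fun i => pair Ω (pd i (tderiv ψ)) (pd i (tderiv ψ)) t)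
        (fun i _ => pair_self_nonneg _ _ _) (Finset.mem_univ i0)
    calc V t ≤ 4 * R ^ 2 * pair Ω (pd i0 (tderiv ψ)) (pd i0 (tderiv ψ)) t := h1
      _ ≤ 4 * R ^ 2 * G t := by gcongr
      _ ≤ P * G t := by rw [hP]; nlinarith [G0 t]
  have hX : ∀ t, |c ^ 2 * X t| ≤ c ^ 4 / b * A t + b / 4 * G t := by
    intro t
    have ha : 0 < 2 * c ^ 2 / b := by positivity
    have h1 : |X t| ≤ 2 * c ^ 2 / b / 2 * A t + 1 / (2 * (2 * c ^ 2 / b)) * G t := by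
      refine (Finset.abs_sum_le_sum_abs _ _).trans ?_
      rw [hAd, hGd]
      simp only [Finset.mul_sum]
      rw [← Finset.sum_add_distrib]
      exact Finset.sum_le_sum fun i _ => pair_young (hψ.pd i) (hv.pd i) t ha
    rw [abs_mul, abs_of_pos (by positivity : 0 < c ^ 2)]
    calc c ^ 2 * |X t| ≤ c ^ 2 * (2 * c ^ 2 / b / 2 * A t + 1 / (2 * (2 * c ^ 2 / b)) * G t) := by
          gcongr
      _ = _ := by field_simp; ring
  have hE : ∀ t, En Ω L b c ψ t
      = L * (1 / 2 * V t + c ^ 2 / 2 * A t) + b / 2 * G t + c ^ 2 * X t := fun t => rfl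
  have hLc : L * c ^ 2 / 2 = c ^ 4 / b + c ^ 2 := by rw [hL]; field_simp
  have Elow : ∀ t, k * (V t + A t + G t) ≤ En Ω L b c ψ t := by
    intro t
    rw [hE]
    have h1 := (abs_le.1 (hX t)).1
    have h2 : k * V t ≤ L / 2 * V t := by
      apply mul_le_mul_of_nonneg_right _ (V0 t)
      have : 0 ≤ 2 * c ^ 2 / b := by positivity
      linarith
    have h3 := mul_le_mul_of_nonneg_right hk2 (A0 t)
    have h4 := mul_le_mul_of_nonneg_right hk3 (G0 t)
    have h5 : L * c ^ 2 / 2 * A t = c ^ 4 / b * A t + c ^ 2 * A t := by rw [hLc]; ring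
    linarith
  have Eup : En Ω L b c ψ 0 ≤ k2 * (V 0 + A 0 + G 0) := by
    rw [hE]
    have h1 := (abs_le.1 (hX 0)).2
    have q1 : L / 2 ≤ k2 := by
      have : 0 ≤ (L * c ^ 2 / 2 + c ^ 4 / b) + 3 * b / 4 := by positivity
      linarith
    have q2 : L * c ^ 2 / 2 + c ^ 4 / b ≤ k2 := by
      have : 0 ≤ L / 2 + 3 * b / 4 := by positivity
      linarith
    have q3 : 3 * b / 4 ≤ k2 := by
      have : 0 ≤ L / 2 + (L * c ^ 2 / 2 + c ^ 4 / b) := by positivity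
      linarith
    have h2 := mul_le_mul_of_nonneg_right q1 (V0 0)
    have h3 := mul_le_mul_of_nonneg_right q2 (A0 0)
    have h4 := mul_le_mul_of_nonneg_right q3 (G0 0)
    linarith
  set Ed : ℝ → ℝ := fun t => L * (pair Ω (tderiv ψ) (resid b c ψ) t - b * G t)
        + pair Ω (tderiv (tderiv ψ)) (resid b c ψ) t - W t + c ^ 2 * G t with hEdd
  have hder : ∀ t, HasDerivAt (En Ω L b c ψ) (Ed t) t := fun t => hasDerivAt_En hψ L b c t
  have cEd : Continuous Ed := by
    have c1 := continuous_pair hv hg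
    have c2 := continuous_pair hv.tderiv hg
    fun_prop
  have hEd : ∀ t, Ed t ≤ M * F t - δ * (G t + W t) := by
    intro t
    have y1 := (abs_le.1 (pair_young hv hg t (a := b / P) (by positivity))).2
    have y2 := (abs_le.1 (pair_young hv.tderiv hg t (a := 1) one_pos)).2
    have y1' : pair Ω (tderiv ψ) (resid b c ψ) t ≤ b / 2 * G t + P / (2 * b) * F t := by
      have z1 : b / P / 2 * V t ≤ b / P / 2 * (P * G t) := by
        have := hVG t
        gcongr
      have z2 : b / P / 2 * (P * G t) = b / 2 * G t := by field_simp
      have z3 : 1 / (2 * (b / P)) = P / (2 * b) := by field_simp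
      rw [z3] at y1
      linarith
    have y3 := mul_le_mul_of_nonneg_left y1' hL0.le
    have h3 := mul_le_mul_of_nonneg_right hδ1 (G0 t)
    have h4 := mul_le_mul_of_nonneg_right hδ2 (W0 t)
    have h5 : L * b * G t = (2 * c ^ 2 + 2 * b) * G t := by rw [hLb]
    have h6 : M * F t = L * (P / (2 * b)) * F t + 1 / 2 * F t := by rw [hM]; ring
    have y2' : pair Ω (tderiv (tderiv ψ)) (resid b c ψ) t ≤ 1 / 2 * W t + 1 / 2 * F t := by
      norm_num at y2 ⊢
      exact y2
    simp only [hEdd]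
    linarith
  have hint : ∀ t, 0 ≤ t → En Ω L b c ψ t - En Ω L b c ψ 0
      ≤ M * (∫ s in (0:ℝ)..t, F s) - δ * ∫ s in (0:ℝ)..t, (G s + W s) := by
    intro t ht
    have cD : Continuous fun s => δ * (G s + W s) := by fun_prop
    rw [← intervalIntegral.integral_eq_sub_of_hasDerivAt (fun s _ => hder s)
      (cEd.intervalIntegrable _ _), ← intervalIntegral.integral_const_mul,
      ← intervalIntegral.integral_const_mul, ← intervalIntegral.integral_sub
      ((cF.const_mul M).intervalIntegrable _ _)
      (cD.intervalIntegrable _ _)]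
    exact intervalIntegral.integral_mono_on ht (cEd.intervalIntegrable _ _)
      (((cF.const_mul M).sub cD).intervalIntegrable _ _)
      fun s _ => hEd s
  have fF : (∫ t in (0:ℝ)..T, sqL2 Ω (f t)) = ∫ t in (0:ℝ)..T, F t := by
    refine intervalIntegral.integral_congr fun t ht => ?_
    rw [Set.uIcc_of_le hT.le] at ht
    simp only [hFd, ← sqL2_eq]
    unfold sqL2
    refine setIntegral_congr_fun hop.measurableSet fun x hx => ?_
    have := heat t ht x hx
    have e : f t x = resid b c ψ t x := by
      rw [← this]
      have l1 : lap (tderiv ψ t) x = ∑ i, pd i (pd i (tderiv ψ)) t x := rfl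
      have l2 : lap (ψ t) x = ∑ i, pd i (pd i ψ) t x := rfl
      rw [l1, l2, resid]; ring
    simp only [e]
  rw [fF]
  simp only [sqH1, sqL2_eq, sqGrad_eq hψ, sqGrad_eq hv]
  set IF := ∫ t in (0:ℝ)..T, F t with hIF
  have s1 : sqL2 Ω (ψ 0) = pair Ω ψ ψ 0 := sqL2_eq _ _ _
  have Q0 : 0 ≤ pair Ω ψ ψ 0 := pair_self_nonneg _ _ _
  change supIcc T (fun t => V t + A t + G t) + (∫ t in (0:ℝ)..T, (G t + W t))
    ≤ (1 / k + 1 / δ) * (k2 + M) * (pair Ω ψ ψ 0 + A 0 + (V 0 + G 0) + IF)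
  set I := pair Ω ψ ψ 0 + A 0 + (V 0 + G 0) + IF with hI
  have IF0 : 0 ≤ IF := intervalIntegral.integral_nonneg hT.le fun t _ => F0 t
  have bound : En Ω L b c ψ 0 + M * IF ≤ (k2 + M) * I := by
    have a1 := A0 0
    have a2 := V0 0
    have a3 := G0 0
    have b1 : k2 * (V 0 + A 0 + G 0) ≤ k2 * I :=
      mul_le_mul_of_nonneg_left (by linarith) hk20.le
    have b2 : M * IF ≤ M * I := mul_le_mul_of_nonneg_left (by linarith) hM0.le
    linarith
  have part1 : supIcc T (fun t => V t + A t + G t) ≤ 1 / k * ((k2 + M) * I) := by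
    unfold supIcc
    have : Nonempty (Set.Icc (0:ℝ) T) := ⟨⟨0, le_rfl, hT.le⟩⟩
    refine ciSup_le fun t => ?_
    obtain ⟨t, ht0, htT⟩ := t
    simp only
    have h1 := hint t ht0
    have h2 : (∫ s in (0:ℝ)..t, F s) ≤ IF :=
      intervalIntegral.integral_mono_interval le_rfl ht0 htT
        (Filter.Eventually.of_forall F0) (cF.intervalIntegrable _ _)
    have h3 : 0 ≤ ∫ s in (0:ℝ)..t, (G s + W s) :=
      intervalIntegral.integral_nonneg ht0 fun s _ => add_nonneg (G0 s) (W0 s)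
    have h4 := Elow t
    have h5 := mul_le_mul_of_nonneg_left h2 hM0.le
    have h6 := mul_nonneg hδ0.le h3
    rw [one_div, ← div_eq_inv_mul, le_div_iff₀ hk0]
    linarith
  have part2 : (∫ t in (0:ℝ)..T, (G t + W t)) ≤ 1 / δ * ((k2 + M) * I) := by
    have h1 := hint T hT.le
    have h4 : 0 ≤ En Ω L b c ψ T :=
      (mul_nonneg hk0.le (add_nonneg (add_nonneg (V0 T) (A0 T)) (G0 T))).trans (Elow T)
    rw [one_div, ← div_eq_inv_mul, le_div_iff₀ hδ0]
    linarith
  calc _ ≤ 1 / k * ((k2 + M) * I) + 1 / δ * ((k2 + M) * I) := add_le_add part1 part2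
    _ = _ := by ring
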